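/- arXiv:1209.4323 — 3 statements merged into one kernel-verified Lean document; each statement's English description precedes it below -/
import Mathlib

section
/- There exists a constant C > 0 such that for every a > 0 with a ≠ 1, ∫₀^{min(1,a)} (1 − ξ)^{-1/2} (1 − ξ/a)^{-1/2} dξ ≤ C (1 + |log |a − 1||). -/
open MeasureTheory

lemma aux_val (a : ℝ) (ha : 0 < a) (h1 : a ≠ 1) :
    (∫ ξ in Set.Ioo (0 : ℝ) (min 1 a),
          (1 - ξ) ^ (-(1 / 2) : ℝ) * (1 - ξ / a) ^ (-(1 / 2) : ℝ)) =
      √a * (2 * Real.log (1 + √a) - Real.log (abs (a - 1))) := by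
  have hm : (0:ℝ) < min 1 a := lt_min one_pos ha
  let F : ℝ → ℝ := fun ξ => -2 * √a * Real.log (√(1 - ξ) + √(a - ξ))
  let f : ℝ → ℝ := fun ξ => √a / (√(1 - ξ) * √(a - ξ))
  have hcongr : (∫ ξ in Set.Ioo (0 : ℝ) (min 1 a),
          (1 - ξ) ^ (-(1 / 2) : ℝ) * (1 - ξ / a) ^ (-(1 / 2) : ℝ)) =
      ∫ ξ in Set.Ioo (0 : ℝ) (min 1 a), f ξ := by
    apply setIntegral_congr_fun measurableSet_Ioo
    intro x hx
    have hx1 : 0 < 1 - x := by have := hx.2.trans_le (min_le_left _ _); linarith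
    have hx2 : 0 < a - x := by have := hx.2.trans_le (min_le_right _ _); linarith
    have e : 1 - x / a = (a - x) / a := by field_simp
    have hs : 0 < √a := Real.sqrt_pos.2 ha
    have hs1 := Real.sqrt_pos.2 hx1
    have hs2 := Real.sqrt_pos.2 hx2
    simp only [f]
    rw [e, Real.rpow_neg hx1.le, Real.rpow_neg (by positivity), ← Real.sqrt_eq_rpow,
      ← Real.sqrt_eq_rpow, Real.sqrt_div hx2.le]
    field_simp
  have hcont : ContinuousOn F (Set.Icc 0 (min 1 a)) := by
    apply ContinuousOn.mul continuousOn_const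
    apply ContinuousOn.log (by fun_prop)
    intro x hx
    have hx1 := hx.2.trans (min_le_left _ _)
    have hx2 := hx.2.trans (min_le_right _ _)
    apply ne_of_gt
    rcases lt_or_eq_of_le hx1 with h | h
    · have := Real.sqrt_pos.2 (sub_pos.2 h)
      positivity
    · have h' : x < a := lt_of_le_of_ne hx2 (fun h2 => h1 (h2.symm.trans h))
      have := Real.sqrt_pos.2 (sub_pos.2 h')
      positivity
  have hder : ∀ x ∈ Set.Ioo 0 (min 1 a), HasDerivAt F (f x) x := by
    intro x hx
    have hx1 : 0 < 1 - x := by have := hx.2.trans_le (min_le_left _ _); linarith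
    have hx2 : 0 < a - x := by have := hx.2.trans_le (min_le_right _ _); linarith
    have hs1 := Real.sqrt_pos.2 hx1
    have hs2 := Real.sqrt_pos.2 hx2
    have d1 := ((hasDerivAt_id x).const_sub 1).sqrt hx1.ne'
    have d2 := ((hasDerivAt_id x).const_sub a).sqrt hx2.ne'
    have d := ((d1.add d2).log (by simp only [Pi.add_apply, id]; positivity)).const_mul (-2 * √a)
    refine HasDerivAt.congr_deriv (f := F) d ?_
    simp only [f, Pi.add_apply, id]
    field_simp
    ring
  have hint := intervalIntegral.integrableOn_deriv_of_nonneg hcont hder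
    (fun x _ => by simp only [f]; positivity)
  rw [hcongr, ← integral_Ioc_eq_integral_Ioo, ← intervalIntegral.integral_of_le hm.le,
    intervalIntegral.integral_eq_sub_of_hasDerivAt_of_le hm.le hcont hder
      ((intervalIntegrable_iff_integrableOn_Ioc_of_le hm.le).2 hint)]
  have hend : √(1 - min 1 a) + √(a - min 1 a) = √|a - 1| := by
    rcases le_total 1 a with h | h
    · rw [min_eq_left h, abs_of_nonneg (by linarith)]; simp
    · rw [min_eq_right h, abs_of_nonpos (by linarith)]; simp
  simp only [F]
  rw [hend, Real.log_sqrt (abs_nonneg _)]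
  simp
  ring

/-- There is a constant `C > 0` such that for every `a > 0` with `a ≠ 1`,
`∫₀^{min(1,a)} (1 − ξ)^{-1/2} (1 − ξ/a)^{-1/2} dξ ≤ C (1 + |log |a − 1||)`. -/
theorem stmt8 :
    ∃ C > (0 : ℝ), ∀ a : ℝ, 0 < a → a ≠ 1 →
      (∫ ξ in Set.Ioo (0 : ℝ) (min 1 a),
          (1 - ξ) ^ (-(1 / 2) : ℝ) * (1 - ξ / a) ^ (-(1 / 2) : ℝ)) ≤
        C * (1 + abs (Real.log (abs (a - 1)))) := by
  refine ⟨8, by norm_num, fun a ha h1 => ?_⟩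
  rw [aux_val a ha h1]
  have hs : 0 < √a := Real.sqrt_pos.2 ha
  have hsq : √a * √a = a := Real.mul_self_sqrt ha.le
  have hL := abs_nonneg (Real.log |a - 1|)
  rcases le_or_gt (√a) 2 with h | h
  · have l1 := Real.log_le_sub_one_of_pos (show 0 < 1 + √a by positivity)
    have l2 := neg_abs_le (Real.log |a - 1|)
    calc _ ≤ √a * (4 + abs (Real.log |a - 1|)) := by gcongr; linarith
      _ ≤ 2 * (4 + abs (Real.log |a - 1|)) := by gcongr
      _ ≤ _ := by linarith
  · have e : |a - 1| = (√a - 1) * (1 + √a) := by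
      rw [abs_of_nonneg (by nlinarith)]; linarith
    have hp : 0 < √a - 1 := by linarith
    have key : 2 * Real.log (1 + √a) - Real.log |a - 1| ≤ 2 / (√a - 1) := by
      have l := Real.log_le_sub_one_of_pos (show 0 < (1 + √a) / (√a - 1) by positivity)
      rw [Real.log_div (by positivity) hp.ne'] at l
      rw [e, Real.log_mul hp.ne' (by positivity)]
      have : (1 + √a) / (√a - 1) - 1 = 2 / (√a - 1) := by field_simp; ring
      linarith
    calc _ ≤ √a * (2 / (√a - 1)) := by gcongr
      _ ≤ 4 := by rw [← mul_div_assoc, div_le_iff₀ hp]; linarith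
      _ ≤ _ := by linarith
end

section
/- There exists a constant C' > 0 such that for every ρ > 0, ∫_{ρ/2}^∞ e^{-πτ²} (1 − (ρ/(2τ))²)^{-1/2} dτ ≤ (2π/3) ρ e^{-πρ²/4} + C' e^{-πρ²/2}. -/
open MeasureTheory Real

lemma aux_image (a : ℝ) (ha : 0 < a) :
    (fun t : ℝ => √(t ^ 2 - a ^ 2)) '' Set.Ioi a = Set.Ioi 0 := by
  ext u
  simp only [Set.mem_image, Set.mem_Ioi]
  constructor
  · rintro ⟨t, ht, rfl⟩
    apply Real.sqrt_pos.2
    nlinarith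
  · intro hu
    refine ⟨√(u ^ 2 + a ^ 2), ?_, ?_⟩
    · apply Real.lt_sqrt_of_sq_lt
      nlinarith
    · rw [Real.sq_sqrt (by positivity)]
      simp [Real.sqrt_sq hu.le]

lemma aux_int (a : ℝ) (ha : 0 < a) :
    (∫ t in Set.Ioi a, Real.exp (-(π * t ^ 2)) * (1 - (a / t) ^ 2) ^ (-(1 / 2) : ℝ)) =
      1 / 2 * Real.exp (-(π * a ^ 2)) := by
  have h1 := integral_image_eq_integral_abs_deriv_smul (s := Set.Ioi a)
    (f := fun t : ℝ => √(t ^ 2 - a ^ 2)) (f' := fun t => t / √(t ^ 2 - a ^ 2))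
    measurableSet_Ioi
    (by
      intro t ht
      have ht : a < t := ht
      have hp : 0 < t ^ 2 - a ^ 2 := by nlinarith
      have h := (((hasDerivAt_id t).pow 2).sub_const (a ^ 2)).sqrt hp.ne'
      refine (h.congr_deriv ?_).hasDerivWithinAt
      simp
      field_simp)
    (by
      intro x hx y hy hxy
      have hx : a < x := hx
      have hy : a < y := hy
      have h2 := (Real.sqrt_inj (by nlinarith) (by nlinarith)).1 hxy
      nlinarith [mul_self_eq_mul_self_iff.1 (show x * x = y * y by linarith), sq_nonneg (x - y)])
    (fun u => Real.exp (-(π * a ^ 2)) * Real.exp (-π * u ^ 2))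
  rw [aux_image a ha, integral_const_mul, integral_gaussian_Ioi, div_self pi_pos.ne'] at h1
  rw [Real.sqrt_one] at h1
  rw [mul_comm, h1]
  refine setIntegral_congr_fun measurableSet_Ioi ?_
  intro t ht
  have ht : a < t := ht
  have ht0 : 0 < t := ha.trans ht
  have hp : 0 < t ^ 2 - a ^ 2 := by nlinarith
  have e : 1 - (a / t) ^ 2 = (t ^ 2 - a ^ 2) / t ^ 2 := by field_simp
  simp only [smul_eq_mul]
  rw [e, Real.rpow_neg (by positivity), ← Real.sqrt_eq_rpow, Real.sqrt_div hp.le,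
    Real.sqrt_sq ht0.le, Real.sq_sqrt hp.le, ← Real.exp_add, abs_of_pos (by positivity), inv_div,
    mul_comm]
  congr 2
  ring

/-- There is a constant `C' > 0` such that for every `ρ > 0`,
`∫_{ρ/2}^∞ e^{-πτ²} (1 − (ρ/(2τ))²)^{-1/2} dτ ≤ (2π/3) ρ e^{-πρ²/4} + C' e^{-πρ²/2}`. -/
theorem stmt11 :
    ∃ C' > (0 : ℝ), ∀ ρ : ℝ, 0 < ρ →
      (∫ τ in Set.Ioi (ρ / 2),
          Real.exp (-(π * τ ^ 2)) * (1 - (ρ / (2 * τ)) ^ 2) ^ (-(1 / 2) : ℝ)) ≤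
        2 * π / 3 * ρ * Real.exp (-(π * ρ ^ 2 / 4)) + C' * Real.exp (-(π * ρ ^ 2 / 2)) := by
  refine ⟨Real.exp (π / 4), Real.exp_pos _, fun ρ hρ => ?_⟩
  have h := aux_int (ρ / 2) (by positivity)
  simp only [div_div] at h ⊢
  rw [h, show π * (ρ / 2) ^ 2 = π * ρ ^ 2 / 4 by ring]
  have hpi := Real.pi_gt_three
  have hE := Real.exp_pos (-(π * ρ ^ 2 / 4))
  rcases le_total 1 ρ with h1 | h1
  · have : 1 / 2 ≤ 2 * π / 3 * ρ := by nlinarith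
    have := mul_le_mul_of_nonneg_right this hE.le
    have : 0 < Real.exp (π / 4) * Real.exp (-(π * ρ ^ 2 / 2)) := by positivity
    linarith
  · have h2 : Real.exp (-(π * ρ ^ 2 / 4)) ≤ Real.exp (π / 4) * Real.exp (-(π * ρ ^ 2 / 2)) := by
      rw [← Real.exp_add]
      apply Real.exp_le_exp.2
      have : ρ ^ 2 ≤ 1 := by nlinarith
      nlinarith
    have : 0 < 2 * π / 3 * ρ * Real.exp (-(π * ρ ^ 2 / 4)) := by positivity
    linarith
end

section
/- The double integral ∫₀^∞ ρ ( ∫_{ρ/2}^∞ e^{-πτ²} (1 − (ρ/(2τ))²)^{-1/2} dτ ) dρ is finite. -/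
open MeasureTheory Real

lemma aux_pt (a s : ℝ) (ha : 0 < a) (hs : 0 < s) :
    Real.exp (-(π * (s + a) ^ 2)) * (1 - (2 * a / (2 * (s + a))) ^ 2) ^ (-(1 / 2) : ℝ) ≤
      ((1 + a) * Real.exp (-π * a ^ 2)) *
      (s ^ (-(1 / 2) : ℝ) * Real.exp (-π * s ^ 2) + s ^ (1 / 2 : ℝ) * Real.exp (-π * s ^ 2)) := by
  have hpos : 0 < s + a := by positivity
  have h1 : s / (s + a) ≤ 1 - (2 * a / (2 * (s + a))) ^ 2 := by
    have : 1 - (2 * a / (2 * (s + a))) ^ 2 - s / (s + a) = s * a / (s + a) ^ 2 := by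
      field_simp
      ring
    have h : 0 ≤ s * a / (s + a) ^ 2 := by positivity
    linarith
  have h2 : (1 - (2 * a / (2 * (s + a))) ^ 2) ^ (-(1 / 2) : ℝ) ≤ (s / (s + a)) ^ (-(1 / 2) : ℝ) :=
    Real.rpow_le_rpow_of_nonpos (by positivity) h1 (by norm_num)
  have h3 : (s / (s + a)) ^ (-(1 / 2) : ℝ) = s ^ (-(1 / 2) : ℝ) * (s + a) ^ (1 / 2 : ℝ) := by
    rw [Real.div_rpow hs.le hpos.le, Real.rpow_neg hpos.le, div_inv_eq_mul]
  have h4 : (s + a) ^ (1 / 2 : ℝ) ≤ (1 + a) * (1 + s) := by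
    rw [← Real.sqrt_eq_rpow]
    apply Real.sqrt_le_iff.2
    constructor
    · positivity
    · nlinarith [mul_pos ha hs, sq_nonneg (a * s + a + s)]
  have h5 : s ^ (1 / 2 : ℝ) = s ^ (-(1 / 2) : ℝ) * s := by
    rw [← Real.rpow_add_one hs.ne']
    norm_num
  have h6 : Real.exp (-(π * (s + a) ^ 2)) ≤ Real.exp (-π * a ^ 2) * Real.exp (-π * s ^ 2) := by
    rw [← Real.exp_add]
    apply Real.exp_le_exp.2
    nlinarith [mul_pos Real.pi_pos (mul_pos ha hs)]
  have h7 : 0 ≤ s ^ (-(1 / 2) : ℝ) := by positivity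
  calc _ ≤ (Real.exp (-π * a ^ 2) * Real.exp (-π * s ^ 2)) *
        (s ^ (-(1 / 2) : ℝ) * ((1 + a) * (1 + s))) := by
        apply mul_le_mul h6 _ _ (by positivity)
        · rw [h3] at h2
          exact h2.trans (mul_le_mul_of_nonneg_left h4 h7)
        · exact Real.rpow_nonneg (le_trans (by positivity) h1) _
    _ = _ := by rw [h5]; ring

lemma aux_inner (ρ : ℝ) (hρ : 0 < ρ) :
    (∫⁻ τ in Set.Ioi (ρ / 2),
          ENNReal.ofReal (Real.exp (-(π * τ ^ 2)) * (1 - (ρ / (2 * τ)) ^ 2) ^ (-(1 / 2) : ℝ))) ≤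
    ENNReal.ofReal ((1 + ρ / 2) * Real.exp (-π * (ρ / 2) ^ 2)) *
    ∫⁻ s in Set.Ioi (0 : ℝ), ENNReal.ofReal
      (s ^ (-(1 / 2) : ℝ) * Real.exp (-π * s ^ 2) + s ^ (1 / 2 : ℝ) * Real.exp (-π * s ^ 2)) := by
  have hm : MeasurePreserving (fun s : ℝ => s + ρ / 2) volume volume :=
    measurePreserving_add_right volume (ρ / 2)
  rw [← hm.setLIntegral_comp_preimage_emb (measurableEmbedding_addRight (ρ / 2)),
    ← lintegral_const_mul' _ _ ENNReal.ofReal_ne_top]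
  have : (fun s : ℝ => s + ρ / 2) ⁻¹' Set.Ioi (ρ / 2) = Set.Ioi 0 := by
    ext; simp
  rw [this]
  apply setLIntegral_mono' measurableSet_Ioi
  intro s hs
  rw [← ENNReal.ofReal_mul (by positivity)]
  apply ENNReal.ofReal_le_ofReal
  have := aux_pt (ρ / 2) s (by positivity) hs
  rwa [show 2 * (ρ / 2) = ρ by ring] at this

/-- The double integral
`∫₀^∞ ρ (∫_{ρ/2}^∞ e^{-πτ²} (1 − (ρ/(2τ))²)^{-1/2} dτ) dρ` is finite. -/
theorem stmt12 :
    (∫⁻ ρ in Set.Ioi (0 : ℝ), ENNReal.ofReal ρ *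
        ∫⁻ τ in Set.Ioi (ρ / 2),
          ENNReal.ofReal (Real.exp (-(π * τ ^ 2)) * (1 - (ρ / (2 * τ)) ^ 2) ^ (-(1 / 2) : ℝ)))
      < ⊤ := by
  have hC : (∫⁻ s in Set.Ioi (0 : ℝ), ENNReal.ofReal
      (s ^ (-(1 / 2) : ℝ) * Real.exp (-π * s ^ 2) + s ^ (1 / 2 : ℝ) * Real.exp (-π * s ^ 2)))
      < ⊤ :=
    ((integrableOn_rpow_mul_exp_neg_mul_sq Real.pi_pos (by norm_num)).add
      (integrableOn_rpow_mul_exp_neg_mul_sq Real.pi_pos (by norm_num))).lintegral_lt_top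
  have hD : (∫⁻ ρ in Set.Ioi (0 : ℝ), ENNReal.ofReal
      (ρ ^ (1 : ℝ) * Real.exp (-(π / 4) * ρ ^ 2) +
        1 / 2 * (ρ ^ (2 : ℝ) * Real.exp (-(π / 4) * ρ ^ 2)))) < ⊤ :=
    ((integrableOn_rpow_mul_exp_neg_mul_sq (by positivity) (by norm_num)).add
      ((integrableOn_rpow_mul_exp_neg_mul_sq (by positivity)
        (by norm_num)).const_mul (1 / 2))).lintegral_lt_top
  refine lt_of_le_of_lt ?_ (ENNReal.mul_lt_top hD hC)
  rw [← lintegral_mul_const' _ _ hC.ne]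
  apply setLIntegral_mono' measurableSet_Ioi
  intro ρ hρ
  have hρ' : 0 < ρ := hρ
  refine (mul_le_mul_right (aux_inner ρ hρ') _).trans (le_of_eq ?_)
  rw [← mul_assoc, ← ENNReal.ofReal_mul hρ'.le]
  congr 2
  rw [Real.rpow_one, Real.rpow_two, show -π * (ρ / 2) ^ 2 = -(π / 4) * ρ ^ 2 by ring]
  ring
end
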